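/- Let α, β, γ ∈ ℂ with α + β + γ = 0 and let u be four times continuously differentiable on an open set U ⊆ ℂ⁴. Then the Euler–Lagrange expression of the Lagrangian L = α(u₁u₂u_{34} + u₃u₄u_{12}) + β(u₁u₃u_{24} + u₂u₄u_{13}) + γ(u₁u₄u_{23} + u₂u₃u_{14}), namely −∂₁(αu₂u_{34} + βu₃u_{24} + γu₄u_{23}) − ∂₂(αu₁u_{34} + βu₄u_{13} + γu₃u_{14}) − ∂₃(αu₄u_{12} + βu₁u_{24} + γu₂u_{14}) − ∂₄(αu₃u_{12} + βu₂u_{13} + γu₁u_{23}) + ∂₃∂₄(αu₁u₂) + ∂₁∂₂(αu₃u₄) + ∂₂∂₄(βu₁u₃) + ∂₁∂₃(βu₂u₄) + ∂₂∂₃(γu₁u₄) + ∂₁∂₄(γu₂u₃), equals −6(αu_{12}u_{34} + βu_{13}u_{24} + γu_{14}u_{23}) identically on U. Hence the general heavenly equation is the Euler–Lagrange equation of L. -/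

import Mathlib

/-!  Coordinates: `z : Fin 4 → ℂ` with paper indices `z¹,z²,z³,z⁴` corresponding to
`z 0, z 1, z 2, z 3`.  `pd i f` is the partial derivative ∂f/∂zⁱ. -/

/-- Partial derivative of `f : ℂ⁴ → ℂ` in the `i`-th coordinate direction. -/
noncomputable def pd (i : Fin 4) (f : (Fin 4 → ℂ) → ℂ) : (Fin 4 → ℂ) → ℂ :=
  fun z => fderiv ℂ f z (Pi.single i 1)


lemma pd_contDiffOn {U : Set (Fin 4 → ℂ)} (hU : IsOpen U) {n : ℕ} {f : (Fin 4 → ℂ) → ℂ}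
    (hf : ContDiffOn ℂ (n + 1 : ℕ) f U) (i : Fin 4) : ContDiffOn ℂ n (pd i f) U := by
  have h : ContDiffOn ℂ n (fderiv ℂ f) U := hf.fderiv_of_isOpen hU (by norm_cast)
  exact h.clm_apply contDiffOn_const

lemma pd_mul {f g : (Fin 4 → ℂ) → ℂ} {z : Fin 4 → ℂ} (c : ℂ) (i : Fin 4)
    (hf : DifferentiableAt ℂ f z) (hg : DifferentiableAt ℂ g z) :
    pd i (fun w => c * f w * g w) z = c * (pd i f z * g z + f z * pd i g z) := by
  have h := ((hf.hasFDerivAt.const_mul c).mul hg.hasFDerivAt).fderiv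
  have h' : fderiv ℂ (fun w => c * f w * g w) z = _ := h
  simp only [pd, h']
  simp
  ring

lemma pd_add {f g : (Fin 4 → ℂ) → ℂ} {z : Fin 4 → ℂ} (i : Fin 4)
    (hf : DifferentiableAt ℂ f z) (hg : DifferentiableAt ℂ g z) :
    pd i (fun w => f w + g w) z = pd i f z + pd i g z := by
  have h' : fderiv ℂ (fun w => f w + g w) z = _ := (hf.hasFDerivAt.add hg.hasFDerivAt).fderiv
  simp only [pd, h']
  simp

lemma pd_congr {U : Set (Fin 4 → ℂ)} (hU : IsOpen U) {f g : (Fin 4 → ℂ) → ℂ}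
    (h : ∀ z ∈ U, f z = g z) (i : Fin 4) : ∀ z ∈ U, pd i f z = pd i g z := by
  intro z hz
  have : f =ᶠ[nhds z] g := by
    filter_upwards [hU.mem_nhds hz] with w hw using h w hw
  simp only [pd, this.fderiv_eq]

lemma pd_comm {U : Set (Fin 4 → ℂ)} (hU : IsOpen U) {f : (Fin 4 → ℂ) → ℂ}
    (hf : ContDiffOn ℂ 2 f U) (i j : Fin 4) : ∀ z ∈ U, pd i (pd j f) z = pd j (pd i f) z := by
  intro z hz
  have hc : ContDiffAt ℂ 2 f z := hf.contDiffAt (hU.mem_nhds hz)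
  have hs : IsSymmSndFDerivAt ℂ f z := hc.isSymmSndFDerivAt (by simp)
  have hd : DifferentiableAt ℂ (fderiv ℂ f) z :=
    (hc.fderiv_right (m := 1) (by norm_num)).differentiableAt (by norm_num)
  have key : ∀ a b : Fin 4, pd a (pd b f) z
      = fderiv ℂ (fderiv ℂ f) z (Pi.single a 1) (Pi.single b 1) := by
    intro a b
    have h' :=
      (hd.hasFDerivAt.clm_apply (hasFDerivAt_const (Pi.single b (1 : ℂ)) z)).fderiv
    change fderiv ℂ (fun y => fderiv ℂ f y (Pi.single b (1 : ℂ))) z _ = _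
    rw [h']
    simp
  rw [key, key]
  exact hs _ _

lemma pd_pd_mul {U : Set (Fin 4 → ℂ)} (hU : IsOpen U) {f g : (Fin 4 → ℂ) → ℂ}
    (hf : ContDiffOn ℂ 2 f U) (hg : ContDiffOn ℂ 2 g U) (c : ℂ) (i j : Fin 4)
    {z : Fin 4 → ℂ} (hz : z ∈ U) :
    pd i (pd j (fun w => c * f w * g w)) z = c * (pd i (pd j f) z * g z + pd j f z * pd i g z)
      + c * (pd i f z * pd j g z + f z * pd i (pd j g) z) := by
  have d : ∀ {h : (Fin 4 → ℂ) → ℂ}, ContDiffOn ℂ 2 h U → ∀ w ∈ U, DifferentiableAt ℂ h w :=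
    fun hh w hw => (hh.contDiffAt (hU.mem_nhds hw)).differentiableAt (by norm_num)
  have d' : ∀ {h : (Fin 4 → ℂ) → ℂ}, ContDiffOn ℂ 2 h U → ∀ k, ∀ w ∈ U,
      DifferentiableAt ℂ (pd k h) w :=
    fun hh k w hw => ((pd_contDiffOn hU (n := 1) hh k).contDiffAt
      (hU.mem_nhds hw)).differentiableAt (by norm_num)
  have h1 : ∀ w ∈ U, pd j (fun w => c * f w * g w) w
      = c * pd j f w * g w + c * f w * pd j g w := by
    intro w hw
    rw [pd_mul c j (d hf w hw) (d hg w hw)]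
    ring
  rw [pd_congr hU h1 i z hz, pd_add, pd_mul c i (d' hf j z hz) (d hg z hz),
    pd_mul c i (d hf z hz) (d' hg j z hz)]
  · exact ((d' hf j z hz).const_mul c).mul (d hg z hz)
  · exact ((d hf z hz).const_mul c).mul (d' hg j z hz)

/-- the Euler–Lagrange expression of the Lagrangian
`L = α(u₁u₂u₃₄ + u₃u₄u₁₂) + β(u₁u₃u₂₄ + u₂u₄u₁₃) + γ(u₁u₄u₂₃ + u₂u₃u₁₄)`
equals `−6(αu₁₂u₃₄ + βu₁₃u₂₄ + γu₁₄u₂₃)` identically on `U`; hence the general heavenly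
equation is the Euler–Lagrange equation of `L`. -/
theorem euler_lagrange_of_heavenly_lagrangian
    (α β γ : ℂ) (hαβγ : α + β + γ = 0)
    (U : Set (Fin 4 → ℂ)) (hU : IsOpen U)
    (u : (Fin 4 → ℂ) → ℂ) (hu : ContDiffOn ℂ 4 u U) :
    ∀ z ∈ U,
      -(pd 0 (fun w => α * pd 1 u w * pd 2 (pd 3 u) w
          + β * pd 2 u w * pd 1 (pd 3 u) w + γ * pd 3 u w * pd 1 (pd 2 u) w) z)
      - pd 1 (fun w => α * pd 0 u w * pd 2 (pd 3 u) w
          + β * pd 3 u w * pd 0 (pd 2 u) w + γ * pd 2 u w * pd 0 (pd 3 u) w) z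
      - pd 2 (fun w => α * pd 3 u w * pd 0 (pd 1 u) w
          + β * pd 0 u w * pd 1 (pd 3 u) w + γ * pd 1 u w * pd 0 (pd 3 u) w) z
      - pd 3 (fun w => α * pd 2 u w * pd 0 (pd 1 u) w
          + β * pd 1 u w * pd 0 (pd 2 u) w + γ * pd 0 u w * pd 1 (pd 2 u) w) z
      + pd 2 (pd 3 (fun w => α * pd 0 u w * pd 1 u w)) z
      + pd 0 (pd 1 (fun w => α * pd 2 u w * pd 3 u w)) z
      + pd 1 (pd 3 (fun w => β * pd 0 u w * pd 2 u w)) z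
      + pd 0 (pd 2 (fun w => β * pd 1 u w * pd 3 u w)) z
      + pd 1 (pd 2 (fun w => γ * pd 0 u w * pd 3 u w)) z
      + pd 0 (pd 3 (fun w => γ * pd 1 u w * pd 2 u w)) z
      = -6 * (α * pd 0 (pd 1 u) z * pd 2 (pd 3 u) z
          + β * pd 0 (pd 2 u) z * pd 1 (pd 3 u) z
          + γ * pd 0 (pd 3 u) z * pd 1 (pd 2 u) z) := by
  intro z hz
  have c1 : ∀ i, ContDiffOn ℂ 3 (pd i u) U := fun i => pd_contDiffOn hU (n := 3) hu i
  have c2 : ∀ i j, ContDiffOn ℂ 2 (pd i (pd j u)) U :=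
    fun i j => pd_contDiffOn hU (n := 2) (c1 j) i
  have c1' : ∀ i, ContDiffOn ℂ 2 (pd i u) U := fun i => (c1 i).of_le (by norm_num)
  have d1 : ∀ i, DifferentiableAt ℂ (pd i u) z := fun i =>
    ((c1 i).contDiffAt (hU.mem_nhds hz)).differentiableAt (by norm_num)
  have d2 : ∀ i j, DifferentiableAt ℂ (pd i (pd j u)) z := fun i j =>
    ((c2 i j).contDiffAt (hU.mem_nhds hz)).differentiableAt (by norm_num)
  have s2 : ∀ i j, ∀ w ∈ U, pd i (pd j u) w = pd j (pd i u) w :=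
    fun i j => pd_comm hU (hu.of_le (by norm_num)) i j
  have t1 : ∀ i j k, pd i (pd j (pd k u)) z = pd j (pd i (pd k u)) z :=
    fun i j k => pd_comm hU (c1' k) i j z hz
  have t2 : ∀ i j k, pd i (pd j (pd k u)) z = pd i (pd k (pd j u)) z :=
    fun i j k => pd_congr hU (s2 j k) i z hz
  have e : ∀ (i a b c a' b' c' a'' b'' c'' : Fin 4) (x y t : ℂ),
      pd i (fun w => x * pd a u w * pd b (pd c u) w + y * pd a' u w * pd b' (pd c' u) w
        + t * pd a'' u w * pd b'' (pd c'' u) w) z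
      = x * (pd i (pd a u) z * pd b (pd c u) z + pd a u z * pd i (pd b (pd c u)) z)
      + y * (pd i (pd a' u) z * pd b' (pd c' u) z + pd a' u z * pd i (pd b' (pd c' u)) z)
      + t * (pd i (pd a'' u) z * pd b'' (pd c'' u) z
        + pd a'' u z * pd i (pd b'' (pd c'' u)) z) := by
    intro i a b c a' b' c' a'' b'' c'' x y t
    have m : ∀ (a b c : Fin 4) (x : ℂ),
        DifferentiableAt ℂ (fun w => x * pd a u w * pd b (pd c u) w) z :=
      fun a b c x => ((d1 a).const_mul x).mul (d2 b c)
    have m2 : DifferentiableAt ℂ (fun w => x * pd a u w * pd b (pd c u) w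
        + y * pd a' u w * pd b' (pd c' u) w) z := (m a b c x).add (m a' b' c' y)
    rw [pd_add i m2 (m a'' b'' c'' t),
      pd_add i (m a b c x) (m a' b' c' y), pd_mul x i (d1 a) (d2 b c),
      pd_mul y i (d1 a') (d2 b' c'), pd_mul t i (d1 a'') (d2 b'' c'')]
  simp only [e, pd_pd_mul hU (c1' _) (c1' _) _ _ _ hz]
  have hγ : γ = -α - β := by linear_combination hαβγ
  subst hγ
  simp only [s2 1 0 z hz, t1 1 0 2, t2 2 1 0, t1 1 0 3, t2 3 1 0, s2 2 0 z hz,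
    t1 2 0 1, t2 1 2 0, t1 2 0 3, t2 3 2 0, s2 2 1 z hz, t1 2 1 0,
    t2 0 2 1, t1 2 1 3, t2 3 2 1, s2 3 0 z hz, t1 3 0 1, t2 1 3 0,
    t1 3 0 2, t2 2 3 0, s2 3 1 z hz, t1 3 1 0, t2 0 3 1, t1 3 1 2,
    t2 2 3 1, s2 3 2 z hz, t1 3 2 0, t2 0 3 2, t1 3 2 1, t2 1 3 2]
  ring
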